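/- Define the full objective J(U, V, Σ) = (1/(2η_dec²)) [ ‖U Vᵀ − Z‖_F² + Tr(U Σ Uᵀ) + β(η_dec²/η_enc²)‖V‖_F² ] + (β/2) Σ_{i=1}^{d1} ( σ_i²/η_enc² − 1 − log(σ_i²/η_enc²) ), where Σ = diag(σ_1²,…,σ_{d1}²) ranges over diagonal matrices with all σ_i > 0. Then the infimum of J over all U ∈ ℝ^{d2×d1}, V ∈ ℝ^{d0×d1}, and such Σ is attained and equals (1/(2η_dec²)) [ Σ_{i=1}^{d*} ζ_i² − Σ_{i ≤ d1, ζ_i² > β η_dec²} ζ_i² ( 1 + (β η_dec²/ζ_i²)( log(β η_dec²/ζ_i²) − 1 ) ) ]. -/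

import Mathlib

open Matrix BigOperators

noncomputable def frobSq {m n : ℕ} (M : Matrix (Fin m) (Fin n) ℝ) : ℝ :=
  ∑ i, ∑ j, (M i j) ^ 2

/-- The gain function. -/
noncomputable def gainG (c y : ℝ) : ℝ :=
  if c < y then y * (1 + (c / y) * (Real.log (c / y) - 1)) else 0

/-- The rectangular diagonal matrix. -/
noncomputable def rectD (d2 d0 : ℕ) (ζ : ℕ → ℝ) : Matrix (Fin d2) (Fin d0) ℝ :=
  Matrix.of fun (i : Fin d2) (j : Fin d0) => if (i : ℕ) = (j : ℕ) then ζ i else 0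

lemma gain_bound (c y t : ℝ) (hc : 0 < c) (hy : 0 ≤ y) (ht : 0 ≤ t) :
    t / (1 + t) * y - c * Real.log (1 + t) ≤ gainG c y := by
  have h1 : 0 < 1 + t := by linarith
  unfold gainG
  split_ifs with h
  · have hy0 : 0 < y := hc.trans h
    have h2 : 0 < y / (c * (1 + t)) := by positivity
    have h3 := Real.log_le_sub_one_of_pos h2
    rw [Real.log_div hy0.ne' (by positivity), Real.log_mul hc.ne' h1.ne'] at h3
    rw [Real.log_div hc.ne' hy0.ne']
    have h4 := mul_le_mul_of_nonneg_left h3 hc.le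
    have e1 : t / (1 + t) * y = y - y / (1 + t) := by field_simp; ring
    have e2 : c * (y / (c * (1 + t)) - 1) = y / (1 + t) - c := by field_simp
    have e3 : y * (1 + c / y * (Real.log c - Real.log y - 1))
        = y + c * (Real.log c - Real.log y - 1) := by field_simp
    rw [e1, e3]; rw [e2] at h4
    linarith
  · have h2 : 0 < 1 / (1 + t) := by positivity
    have h3 := Real.log_le_sub_one_of_pos h2
    rw [one_div, Real.log_inv] at h3
    have e1 : t / (1 + t) = 1 - (1 + t)⁻¹ := by field_simp; ring
    have h5 : 0 ≤ t / (1 + t) := by positivity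
    have h6 : t / (1 + t) * y ≤ t / (1 + t) * c := mul_le_mul_of_nonneg_left (by linarith) h5
    have h7 : t / (1 + t) ≤ Real.log (1 + t) := by rw [e1]; linarith
    nlinarith

lemma gain_eq (c y : ℝ) (hc : 0 < c) (hy : c < y) :
    gainG c y = (y / c - 1) / (1 + (y / c - 1)) * y - c * Real.log (1 + (y / c - 1)) := by
  have hy0 : 0 < y := hc.trans hy
  unfold gainG
  rw [if_pos hy, add_sub_cancel, Real.log_div hc.ne' hy0.ne', Real.log_div hy0.ne' hc.ne']
  field_simp
  ring

lemma gain_nonneg (c y : ℝ) (hc : 0 < c) (hy : 0 ≤ y) : 0 ≤ gainG c y := by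
  simpa using gain_bound c y 0 hc hy le_rfl

lemma gain_mono (c y y' : ℝ) (hc : 0 < c) (hy : 0 ≤ y) (h : y ≤ y') :
    gainG c y ≤ gainG c y' := by
  by_cases hcy : c < y
  · rw [gain_eq c y hc hcy]
    have h1 : 0 ≤ y / c - 1 := by
      rw [sub_nonneg, le_div_iff₀ hc]; linarith
    refine le_trans ?_ (gain_bound c y' (y / c - 1) hc (hy.trans h) h1)
    have : 0 ≤ (y / c - 1) / (1 + (y / c - 1)) := by positivity
    nlinarith
  · have : gainG c y = 0 := by simp [gainG, hcy]
    rw [this]; exact gain_nonneg c y' hc (hy.trans h)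

lemma frobSq_eq_trace {m n : ℕ} (M : Matrix (Fin m) (Fin n) ℝ) :
    frobSq M = Matrix.trace (Mᵀ * M) := by
  simp only [frobSq, Matrix.trace, Matrix.diag, Matrix.mul_apply, Matrix.transpose_apply, pow_two]
  exact Finset.sum_comm

lemma frobSq_transpose {m n : ℕ} (M : Matrix (Fin m) (Fin n) ℝ) :
    frobSq Mᵀ = frobSq M := by
  simp only [frobSq, Matrix.transpose_apply]
  exact Finset.sum_comm

lemma frobSq_left {m n : ℕ} (O : Matrix (Fin m) (Fin m) ℝ) (hO : Oᵀ * O = 1)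
    (M : Matrix (Fin m) (Fin n) ℝ) : frobSq (O * M) = frobSq M := by
  rw [frobSq_eq_trace, frobSq_eq_trace, Matrix.transpose_mul, Matrix.mul_assoc,
    ← Matrix.mul_assoc Oᵀ, hO, Matrix.one_mul]

lemma frobSq_right {m n : ℕ} (O : Matrix (Fin n) (Fin n) ℝ) (hO : O * Oᵀ = 1)
    (M : Matrix (Fin m) (Fin n) ℝ) : frobSq (M * O) = frobSq M := by
  rw [← frobSq_transpose, Matrix.transpose_mul, frobSq_left _ (by simpa using hO),
    frobSq_transpose]

lemma trace_diag {m n : ℕ} (U : Matrix (Fin m) (Fin n) ℝ) (s : Fin n → ℝ) :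
    Matrix.trace (U * Matrix.diagonal s * Uᵀ) = ∑ j, s j * (Uᵀ * U) j j := by
  rw [Matrix.trace_mul_comm, ← Matrix.mul_assoc]
  simp [Matrix.trace, Matrix.diag, Matrix.mul_diagonal, mul_comm]

lemma expand_frob {d0 d1 d2 : ℕ} (U : Matrix (Fin d2) (Fin d1) ℝ)
    (V : Matrix (Fin d0) (Fin d1) ℝ) (Z : Matrix (Fin d2) (Fin d0) ℝ) (lam : Fin d1 → ℝ)
    (hU : Uᵀ * U = Matrix.diagonal lam) :
    frobSq (U * Vᵀ - Z) = frobSq Z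
      + ∑ j, (lam j * (∑ l, V l j ^ 2) - 2 * ∑ l, V l j * (Zᵀ * U) l j) := by
  have h1 : Matrix.trace ((U * Vᵀ)ᵀ * (U * Vᵀ)) = ∑ j, lam j * (∑ l, V l j ^ 2) := by
    have : (U * Vᵀ)ᵀ * (U * Vᵀ) = V * Matrix.diagonal lam * Vᵀ := by
      rw [← hU]; simp [Matrix.mul_assoc]
    rw [this, trace_diag]
    simp [Matrix.mul_apply, pow_two]
  have h2 : Matrix.trace (Zᵀ * (U * Vᵀ)) = ∑ j, ∑ l, V l j * (Zᵀ * U) l j := by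
    rw [← Matrix.mul_assoc, Matrix.trace, Finset.sum_comm]
    refine Finset.sum_congr rfl fun l _ => ?_
    rw [Matrix.diag, Matrix.mul_apply]
    exact Finset.sum_congr rfl fun j _ => by simp [mul_comm]
  have h3 : Matrix.trace ((U * Vᵀ)ᵀ * Z) = Matrix.trace (Zᵀ * (U * Vᵀ)) := by
    rw [← Matrix.trace_transpose]; simp [Matrix.mul_assoc]
  rw [frobSq_eq_trace, frobSq_eq_trace, Matrix.transpose_sub, Matrix.sub_mul, Matrix.mul_sub,
    Matrix.mul_sub, Matrix.trace_sub, Matrix.trace_sub, Matrix.trace_sub, h3, h1, h2,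
    Finset.sum_sub_distrib, ← Finset.mul_sum]
  ring

lemma bessel {d1 d2 : ℕ} (U : Matrix (Fin d2) (Fin d1) ℝ) (lam : Fin d1 → ℝ)
    (hU : Uᵀ * U = Matrix.diagonal lam) (k : Fin d2) : ∑ j, U k j ^ 2 / lam j ≤ 1 := by
  set r := ∑ j, U k j ^ 2 / lam j with hr
  let w : Fin d1 → ℝ := fun j => U k j / lam j
  let x : Fin d2 → ℝ := U *ᵥ w
  have hxk : x k = r := by
    simp only [x, Matrix.mulVec, dotProduct, w, hr]
    exact Finset.sum_congr rfl fun j _ => by ring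
  have hxx : ∑ i, x i ^ 2 = r := by
    have h1 : ∑ i, x i ^ 2 = x ⬝ᵥ x := by simp [dotProduct, pow_two]
    rw [h1]
    have h2 : x ⬝ᵥ x = w ⬝ᵥ ((Uᵀ * U) *ᵥ w) := by
      simp only [x]
      rw [← Matrix.mulVec_mulVec, Matrix.dotProduct_mulVec, Matrix.dotProduct_mulVec w,
        Matrix.vecMul_transpose, ← Matrix.dotProduct_mulVec]
    rw [h2, hU]
    simp only [dotProduct, Matrix.mulVec_diagonal, w, hr]
    refine Finset.sum_congr rfl fun j _ => ?_
    by_cases h : lam j = 0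
    · simp [h]
    · field_simp
  have h3 : x k ^ 2 ≤ ∑ i, x i ^ 2 :=
    Finset.single_le_sum (f := fun i => x i ^ 2) (fun i _ => sq_nonneg _) (Finset.mem_univ k)
  rw [hxk, hxx] at h3
  nlinarith

lemma lam_eq {d1 d2 : ℕ} (U : Matrix (Fin d2) (Fin d1) ℝ) (lam : Fin d1 → ℝ)
    (hU : Uᵀ * U = Matrix.diagonal lam) (j : Fin d1) : lam j = ∑ k, U k j ^ 2 := by
  have := congrFun (congrFun hU j) j
  simp only [Matrix.mul_apply, Matrix.transpose_apply, Matrix.diagonal_apply_eq] at this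
  rw [← this]; exact Finset.sum_congr rfl fun k _ => by ring

lemma rect_mul {d0 d2 : ℕ} (ζ : ℕ → ℝ) (hz : ∀ i, min d0 d2 ≤ i → ζ i = 0) :
    rectD d2 d0 ζ * (rectD d2 d0 ζ)ᵀ = Matrix.diagonal fun k : Fin d2 => ζ k ^ 2 := by
  ext i k
  rw [Matrix.mul_apply, Matrix.diagonal_apply]
  simp only [rectD, Matrix.transpose_apply, Matrix.of_apply]
  by_cases hi : (i : ℕ) < d0
  · rw [Finset.sum_eq_single ⟨i, hi⟩]
    · by_cases hik : i = k
      · simp [hik, pow_two]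
      · have : ¬ ((k : ℕ) = i) := fun h => hik (Fin.ext h.symm)
        simp [hik, this]
    · intro b _ hb
      have : ¬ ((i : ℕ) = b) := fun h => hb (Fin.ext h.symm)
      simp [this]
    · simp
  · have h0 : ζ i = 0 := hz _ (le_trans (min_le_left _ _) (not_lt.mp hi))
    simp [h0]

lemma rect_frob {d0 d2 : ℕ} (ζ : ℕ → ℝ) (hz : ∀ i, min d0 d2 ≤ i → ζ i = 0) :
    frobSq (rectD d2 d0 ζ) = ∑ i ∈ Finset.range (min d0 d2), ζ i ^ 2 := by
  rw [← frobSq_transpose, frobSq_eq_trace, Matrix.transpose_transpose, rect_mul ζ hz,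
    Matrix.trace_diagonal, Fin.sum_univ_eq_sum_range (fun k => ζ k ^ 2) d2]
  symm
  refine Finset.sum_subset (Finset.range_subset_range.mpr (min_le_right _ _)) ?_
  intro i _ hi
  rw [hz i (not_lt.mp fun h => hi (Finset.mem_range.mpr h))]; simp

lemma rect_col {d0 d1 d2 : ℕ} (ζ : ℕ → ℝ) (hz : ∀ i, min d0 d2 ≤ i → ζ i = 0)
    (U : Matrix (Fin d2) (Fin d1) ℝ) (j : Fin d1) :
    ∑ l, ((rectD d2 d0 ζ)ᵀ * U) l j ^ 2 = ∑ k : Fin d2, ζ k ^ 2 * U k j ^ 2 := by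
  have h : (((rectD d2 d0 ζ)ᵀ * U)ᵀ * ((rectD d2 d0 ζ)ᵀ * U)) j j
      = (Uᵀ * (Matrix.diagonal (fun k : Fin d2 => ζ k ^ 2) * U)) j j := by
    rw [← rect_mul ζ hz]; simp [Matrix.mul_assoc]
  rw [Matrix.mul_apply, Matrix.mul_apply] at h
  simp only [Matrix.transpose_apply, Matrix.diagonal_mul] at h
  simp only [pow_two] at h ⊢
  rw [h]; exact Finset.sum_congr rfl fun k _ => by ring

lemma weights_bound (d1 d2 : ℕ) (g : ℕ → ℝ) (hg : ∀ i, 0 ≤ g i) (hm : ∀ i j, i ≤ j → g j ≤ g i)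
    (r : Fin d2 → ℝ) (r0 : ∀ k, 0 ≤ r k) (r1 : ∀ k, r k ≤ 1) (rs : ∑ k, r k ≤ d1) :
    ∑ k, r k * g k ≤ ∑ i ∈ Finset.range d1, g i := by
  have h1 : ∑ k, r k * g k ≤ ∑ k : Fin d2, (max (g k - g d1) 0 + g d1 * r k) := by
    refine Finset.sum_le_sum fun k _ => ?_
    have a := le_max_left (g k - g d1) 0
    have b := le_max_right (g k - g d1) 0
    nlinarith [r0 k, r1 k, mul_nonneg (r0 k) (sub_nonneg.mpr a), mul_nonneg (sub_nonneg.mpr (r1 k)) b]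
  have h2 : ∑ k : Fin d2, max (g k - g d1) 0 ≤ ∑ i ∈ Finset.range d1, max (g i - g d1) 0 := by
    rw [Fin.sum_univ_eq_sum_range (fun k => max (g k - g d1) 0) d2]
    have h3 : ∑ i ∈ Finset.range d1, max (g i - g d1) 0
        = ∑ i ∈ Finset.range (max d1 d2), max (g i - g d1) 0 := by
      refine Finset.sum_subset (Finset.range_subset_range.mpr (le_max_left _ _)) ?_
      intro i _ hi
      have := hm d1 i (by simpa using hi)
      exact max_eq_right (by linarith)
    rw [h3]
    exact Finset.sum_le_sum_of_subset_of_nonneg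
      (Finset.range_subset_range.mpr (le_max_right _ _)) fun i _ _ => le_max_right _ _
  have h4 : ∑ i ∈ Finset.range d1, max (g i - g d1) 0
      = (∑ i ∈ Finset.range d1, g i) - d1 * g d1 := by
    rw [Finset.sum_congr rfl (g := fun i => g i - g d1)]
    · simp [Finset.sum_sub_distrib]
    · intro i hi
      have := hm i d1 (Finset.mem_range.mp hi).le
      exact max_eq_left (by linarith)
  rw [Finset.sum_add_distrib, ← Finset.mul_sum] at h1
  have h5 := mul_le_mul_of_nonneg_left rs (hg d1)
  linarith

lemma core_bound {d0 d1 d2 : ℕ} (ζ : ℕ → ℝ) (hζmono : ∀ i j, i ≤ j → ζ j ≤ ζ i)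
    (hζnn : ∀ i, 0 ≤ ζ i) (hz : ∀ i, min d0 d2 ≤ i → ζ i = 0)
    (c κ : ℝ) (hc : 0 < c) (hκ : 0 < κ)
    (U : Matrix (Fin d2) (Fin d1) ℝ) (V : Matrix (Fin d0) (Fin d1) ℝ)
    (lam : Fin d1 → ℝ) (hU : Uᵀ * U = Matrix.diagonal lam) :
    (∑ i ∈ Finset.range (min d0 d2), ζ i ^ 2) - ∑ i ∈ Finset.range d1, gainG c (ζ i ^ 2)
      ≤ frobSq (U * Vᵀ - rectD d2 d0 ζ) + κ * frobSq V + c * ∑ j, Real.log (1 + lam j / κ) := by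
  have hl := lam_eq U lam hU
  have hl0 : ∀ j, 0 ≤ lam j := fun j => by
    rw [hl]; exact Finset.sum_nonneg fun k _ => sq_nonneg _
  rw [expand_frob U V _ lam hU, rect_frob ζ hz, ← frobSq_transpose V]
  simp only [frobSq, Matrix.transpose_apply]
  rw [Finset.mul_sum, Finset.mul_sum, add_assoc, add_assoc, ← Finset.sum_add_distrib,
    ← Finset.sum_add_distrib]
  have hterm : ∀ j, -(∑ k : Fin d2, U k j ^ 2 / lam j * gainG c (ζ k ^ 2)) ≤
      (lam j * (∑ l, V l j ^ 2) - 2 * ∑ l, V l j * ((rectD d2 d0 ζ)ᵀ * U) l j)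
      + (κ * ∑ l, V l j ^ 2 + c * Real.log (1 + lam j / κ)) := by
    intro j
    have hp : 0 < lam j + κ := by linarith [hl0 j]
    have a1 : -((∑ l, ((rectD d2 d0 ζ)ᵀ * U) l j ^ 2) / (lam j + κ)) ≤
        (lam j + κ) * (∑ l, V l j ^ 2) - 2 * ∑ l, V l j * ((rectD d2 d0 ζ)ᵀ * U) l j := by
      rw [Finset.sum_div, ← Finset.sum_neg_distrib, Finset.mul_sum, Finset.mul_sum,
        ← Finset.sum_sub_distrib]
      refine Finset.sum_le_sum fun l _ => ?_
      set q := ((rectD d2 d0 ζ)ᵀ * U) l j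
      have : (lam j + κ) * V l j ^ 2 - 2 * (V l j * q) + q ^ 2 / (lam j + κ)
          = (lam j + κ) * (V l j - q / (lam j + κ)) ^ 2 := by
        field_simp
        ring
      have h2 : 0 ≤ (lam j + κ) * (V l j - q / (lam j + κ)) ^ 2 := by positivity
      linarith
    rw [rect_col ζ hz] at a1
    suffices h : (∑ k : Fin d2, ζ k ^ 2 * U k j ^ 2) / (lam j + κ)
        ≤ c * Real.log (1 + lam j / κ) + ∑ k : Fin d2, U k j ^ 2 / lam j * gainG c (ζ k ^ 2) by
      linarith
    rcases (hl0 j).eq_or_lt with h0 | h0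
    · have hk : ∀ k, U k j ^ 2 = 0 := by
        have := hl j
        rw [← h0] at this
        intro k
        exact (Finset.sum_eq_zero_iff_of_nonneg (fun k _ => sq_nonneg (U k j))).mp this.symm k
          (Finset.mem_univ k)
      simp only [hk, ← h0]; simp
    · have hs : ∑ k, U k j ^ 2 / lam j = 1 := by
        rw [← Finset.sum_div, ← hl j, div_self h0.ne']
      have : c * Real.log (1 + lam j / κ)
          = ∑ k, U k j ^ 2 / lam j * (c * Real.log (1 + lam j / κ)) := by
        rw [← Finset.sum_mul, hs, one_mul]
      rw [this, ← Finset.sum_add_distrib, Finset.sum_div]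
      refine Finset.sum_le_sum fun k _ => ?_
      have hb := gain_bound c (ζ k ^ 2) (lam j / κ) hc (sq_nonneg _) (by positivity)
      have hw : 0 ≤ U k j ^ 2 / lam j := by positivity
      have e : ζ k ^ 2 * U k j ^ 2 / (lam j + κ)
          = U k j ^ 2 / lam j * (lam j / κ / (1 + lam j / κ) * ζ k ^ 2) := by
        have : κ + lam j ≠ 0 := by linarith
        have h' : 1 + lam j / κ = (lam j + κ) / κ := by field_simp; ring
        rw [h']
        field_simp
      rw [e, ← mul_add]
      exact mul_le_mul_of_nonneg_left (by linarith) hw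
  have hsum := Finset.sum_le_sum fun j (_ : j ∈ Finset.univ) => hterm j
  rw [Finset.sum_neg_distrib, Finset.sum_comm] at hsum
  simp only [← Finset.sum_mul] at hsum
  have hw := weights_bound d1 d2 (fun i => gainG c (ζ i ^ 2))
    (fun i => gain_nonneg c _ hc (sq_nonneg _))
    (fun i j hij => gain_mono c _ _ hc (sq_nonneg _)
      (pow_le_pow_left₀ (hζnn j) (hζmono i j hij) 2))
    (fun k => ∑ j, U k j ^ 2 / lam j)
    (fun k => Finset.sum_nonneg fun j _ => div_nonneg (sq_nonneg _) (hl0 j))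
    (fun k => bessel U lam hU k)
    (by
      rw [Finset.sum_comm]
      calc _ ≤ ∑ j : Fin d1, (1 : ℝ) := by
            refine Finset.sum_le_sum fun j _ => ?_
            rw [← Finset.sum_div, ← hl j]
            exact div_self_le_one _
        _ = d1 := by simp)
  linarith

lemma exists_diag {d1 d2 : ℕ} (U : Matrix (Fin d2) (Fin d1) ℝ) :
    ∃ (R : Matrix (Fin d1) (Fin d1) ℝ) (lam : Fin d1 → ℝ), Rᵀ * R = 1 ∧ R * Rᵀ = 1 ∧
      (U * R)ᵀ * (U * R) = Matrix.diagonal lam := by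
  have hH : (Uᵀ * U).IsHermitian := by
    simpa using Matrix.isHermitian_conjTranspose_mul_self U
  let R : Matrix (Fin d1) (Fin d1) ℝ := hH.eigenvectorUnitary
  have h1 : Rᵀ * R = 1 := by
    have := Unitary.coe_star_mul_self hH.eigenvectorUnitary
    simpa [Matrix.star_eq_conjTranspose] using this
  have h2 : R * Rᵀ = 1 := mul_eq_one_comm.mp h1
  refine ⟨R, hH.eigenvalues, h1, h2, ?_⟩
  have hs : Uᵀ * U = R * Matrix.diagonal hH.eigenvalues * Rᵀ := by
    have := hH.spectral_theorem
    rw [Unitary.conjStarAlgAut_apply] at this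
    simpa [Matrix.star_eq_conjTranspose, Function.comp_def] using this
  generalize hH.eigenvalues = lam at hs
  rw [Matrix.transpose_mul, Matrix.mul_assoc, ← Matrix.mul_assoc Uᵀ, hs, ← Matrix.mul_assoc,
    ← Matrix.mul_assoc, ← Matrix.mul_assoc, h1, Matrix.one_mul, Matrix.mul_assoc, h1,
    Matrix.mul_one]

lemma sigma_bound {d1 d2 : ℕ} (U : Matrix (Fin d2) (Fin d1) ℝ)
    (R : Matrix (Fin d1) (Fin d1) ℝ) (lam : Fin d1 → ℝ) (h1 : Rᵀ * R = 1) (h2 : R * Rᵀ = 1)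
    (hU : (U * R)ᵀ * (U * R) = Matrix.diagonal lam) (c e : ℝ) (hc : 0 < c) (he : 0 < e)
    (s : Fin d1 → ℝ) (hs : ∀ i, 0 < s i) :
    c * ∑ j, Real.log (1 + lam j / (c / e)) ≤ ∑ i, s i * (Uᵀ * U) i i
      + c * ∑ i, (s i / e - 1 - Real.log (s i / e)) := by
  have hl0 : ∀ j, 0 ≤ lam j := fun j => by
    rw [lam_eq _ _ hU]; exact Finset.sum_nonneg fun k _ => sq_nonneg _
  have hUU : Uᵀ * U = R * Matrix.diagonal lam * Rᵀ := by
    rw [← hU, Matrix.transpose_mul]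
    calc Uᵀ * U = (R * Rᵀ) * (Uᵀ * U) * (R * Rᵀ) := by rw [h2]; simp
      _ = _ := by simp only [Matrix.mul_assoc]
  have hd : ∀ i, (Uᵀ * U) i i = ∑ j, R i j ^ 2 * lam j := by
    intro i
    rw [hUU, Matrix.mul_apply]
    simp only [Matrix.mul_diagonal, Matrix.transpose_apply]
    exact Finset.sum_congr rfl fun j _ => by ring
  have hr : ∀ i, ∑ j, R i j ^ 2 = 1 := by
    intro i
    have := congrFun (congrFun h2 i) i
    simpa [Matrix.mul_apply, pow_two] using this
  have hcol : ∀ j, ∑ i, R i j ^ 2 = 1 := by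
    intro i
    have := congrFun (congrFun h1 i) i
    simpa [Matrix.mul_apply, pow_two] using this
  have hL : c * ∑ j, Real.log (1 + lam j / (c / e))
      = ∑ i, ∑ j, R i j ^ 2 * (c * Real.log (1 + lam j / (c / e))) := by
    rw [Finset.sum_comm, Finset.mul_sum]
    refine Finset.sum_congr rfl fun j _ => ?_
    rw [← Finset.sum_mul, hcol, one_mul]
  rw [hL, Finset.mul_sum, ← Finset.sum_add_distrib]
  refine Finset.sum_le_sum fun i _ => ?_
  have hR : s i * (Uᵀ * U) i i + c * (s i / e - 1 - Real.log (s i / e))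
      = ∑ j, R i j ^ 2 * (s i * lam j + c * (s i / e - 1 - Real.log (s i / e))) := by
    simp only [mul_add, Finset.sum_add_distrib, ← Finset.sum_mul, hr, one_mul, hd i,
      Finset.mul_sum]
    congr 1
    exact Finset.sum_congr rfl fun j _ => by ring
  rw [hR]
  refine Finset.sum_le_sum fun j _ => mul_le_mul_of_nonneg_left ?_ (sq_nonneg _)
  have p1 : 0 < s i / e := div_pos (hs i) he
  have p2 : 0 < 1 + lam j / (c / e) := by have := hl0 j; positivity
  have h3 := Real.log_le_sub_one_of_pos (mul_pos p1 p2)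
  rw [Real.log_mul p1.ne' p2.ne'] at h3
  have h4 := mul_le_mul_of_nonneg_left h3 hc.le
  have e1 : c * (s i / e * (1 + lam j / (c / e)) - 1) = s i * lam j + c * (s i / e - 1) := by
    field_simp
    ring
  rw [e1] at h4
  linarith

/-- The rescaled objective in rotated coordinates. -/
lemma reduce_obj {d0 d1 d2 : ℕ} (ζ : ℕ → ℝ)
    (F : Matrix (Fin d2) (Fin d2) ℝ) (G : Matrix (Fin d0) (Fin d0) ℝ)
    (hF : Fᵀ * F = 1) (hG : Gᵀ * G = 1)
    (U : Matrix (Fin d2) (Fin d1) ℝ) (V : Matrix (Fin d0) (Fin d1) ℝ) :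
    frobSq ((F * U) * (G * V)ᵀ - F * rectD d2 d0 ζ * Gᵀ)
      = frobSq (U * Vᵀ - rectD d2 d0 ζ) := by
  have : (F * U) * (G * V)ᵀ - F * rectD d2 d0 ζ * Gᵀ
      = F * ((U * Vᵀ - rectD d2 d0 ζ) * Gᵀ) := by
    simp [Matrix.sub_mul, Matrix.mul_sub, Matrix.mul_assoc]
  rw [this, frobSq_left F hF, frobSq_right _ (by simpa using hG)]

/-- The explicit minimizer. -/
lemma attained {d0 d1 d2 : ℕ} (ζ : ℕ → ℝ) 
    (hz : ∀ i, min d0 d2 ≤ i → ζ i = 0)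
    (c e : ℝ) (hc : 0 < c) (he : 0 < e) :
    ∃ (U : Matrix (Fin d2) (Fin d1) ℝ) (V : Matrix (Fin d0) (Fin d1) ℝ) (σ : Fin d1 → ℝ),
      (∀ i, 0 < σ i) ∧
      frobSq (U * Vᵀ - rectD d2 d0 ζ) + ∑ i, σ i ^ 2 * (Uᵀ * U) i i + (c / e) * frobSq V
        + c * ∑ i, (σ i ^ 2 / e - 1 - Real.log (σ i ^ 2 / e))
      = (∑ i ∈ Finset.range (min d0 d2), ζ i ^ 2)
        - ∑ i ∈ Finset.range d1, gainG c (ζ i ^ 2) := by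
  let t : ℕ → ℝ := fun j => max (ζ j ^ 2 / c - 1) 0
  have ht0 : ∀ j, 0 ≤ t j := fun j => le_max_right _ _
  have htz : ∀ j, min d0 d2 ≤ j → t j = 0 := by
    intro j hj
    simp [t, hz j hj]
  let lam : Fin d1 → ℝ := fun j => c / e * t j
  have hlam0 : ∀ j, 0 ≤ lam j := fun j => by have := ht0 j; positivity
  let U : Matrix (Fin d2) (Fin d1) ℝ :=
    Matrix.of fun k j => if (k : ℕ) = j then √(lam j) else 0
  have hU : Uᵀ * U = Matrix.diagonal lam := by
    ext i j
    rw [Matrix.mul_apply, Matrix.diagonal_apply]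
    simp only [U, Matrix.transpose_apply, Matrix.of_apply]
    by_cases hi : (i : ℕ) < d2
    · rw [Finset.sum_eq_single ⟨i, hi⟩]
      · by_cases hij : i = j
        · simp [hij, Real.mul_self_sqrt (hlam0 j)]
        · have : ¬ ((i : ℕ) = j) := fun h => hij (Fin.ext h)
          simp [hij, this]
      · intro b _ hb
        have : ¬ ((b : ℕ) = i) := fun h => hb (Fin.ext h)
        simp [this]
      · simp
    · have h0 : lam i = 0 := by
        simp [lam, htz i (le_trans (min_le_right _ _) (not_lt.mp hi))]
      simp [h0]
  let V : Matrix (Fin d0) (Fin d1) ℝ :=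
    Matrix.of fun l j => ((rectD d2 d0 ζ)ᵀ * U) l j / (lam j + c / e)
  let σ : Fin d1 → ℝ := fun j => √(e / (1 + t j))
  have hpos : ∀ j : Fin d1, 0 < e / (1 + t j) := fun j => by have := ht0 j; positivity
  refine ⟨U, V, σ, fun i => Real.sqrt_pos.mpr (hpos i), ?_⟩
  have hσ : ∀ j, σ j ^ 2 = e / (1 + t j) := fun j => Real.sq_sqrt (hpos j).le
  rw [expand_frob U V _ lam hU, rect_frob ζ hz, ← frobSq_transpose V, hU]
  simp only [frobSq, Matrix.transpose_apply, Matrix.diagonal_apply_eq, hσ]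
  rw [Finset.mul_sum, Finset.mul_sum, add_assoc, add_assoc, add_assoc, ← Finset.sum_add_distrib,
    ← Finset.sum_add_distrib, ← Finset.sum_add_distrib, sub_eq_add_neg,
    ← Fin.sum_univ_eq_sum_range (fun i => gainG c (ζ i ^ 2)), ← Finset.sum_neg_distrib]
  congr 1
  refine Finset.sum_congr rfl fun j _ => ?_
  have hq : ∑ l, ((rectD d2 d0 ζ)ᵀ * U) l j ^ 2 = ζ j ^ 2 * lam j := by
    rw [rect_col ζ hz]
    by_cases hj : (j : ℕ) < d2
    · rw [Finset.sum_eq_single ⟨j, hj⟩]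
      · simp [U, Real.sq_sqrt (hlam0 j)]
      · intro b _ hb
        have : ¬ ((b : ℕ) = j) := fun h => hb (Fin.ext h)
        simp [U, this]
      · simp
    · have h0 : lam j = 0 := by
        simp [lam, htz j (le_trans (min_le_right _ _) (not_lt.mp hj))]
      simp [U, h0]
  have hp : 0 < lam j + c / e := by have := hlam0 j; positivity
  have hV1 : ∑ l, V l j ^ 2 = ζ j ^ 2 * lam j / (lam j + c / e) ^ 2 := by
    simp only [V, Matrix.of_apply, div_pow]
    rw [← Finset.sum_div, hq]
  have hV2 : ∑ l, V l j * ((rectD d2 d0 ζ)ᵀ * U) l j = ζ j ^ 2 * lam j / (lam j + c / e) := by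
    rw [← hq, Finset.sum_div]
    exact Finset.sum_congr rfl fun l _ => by simp only [V, Matrix.of_apply]; ring
  have hT : 0 < 1 + t j := by linarith [ht0 j]
  have hlog : Real.log (e / (1 + t j) / e) = - Real.log (1 + t j) := by
    rw [← Real.log_inv]; congr 1; field_simp
  rw [hV1, hV2, hlog]
  have hg : gainG c (ζ j ^ 2) = t j / (1 + t j) * ζ j ^ 2 - c * Real.log (1 + t j) := by
    by_cases h : c < ζ j ^ 2
    · have : t j = ζ j ^ 2 / c - 1 := max_eq_left (by
        rw [sub_nonneg, le_div_iff₀ hc]; linarith)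
      rw [this]; exact gain_eq c _ hc h
    · have : t j = 0 := max_eq_right (by
        rw [sub_nonpos, div_le_iff₀ hc]; linarith)
      simp [this, gainG, h]
  rw [hg]
  have hs : lam j + c / e = c / e * (1 + t j) := by simp only [lam]; ring
  rw [hs]
  simp only [lam]
  field_simp
  ring

/-- the attained minimum value of the full linear VAE objective
(with learnable encoder variances and fixed decoder variance). -/
theorem min_value_full_objective
    (d0 d1 d2 : ℕ) (hd0 : 1 ≤ d0) (hd1 : 1 ≤ d1) (hd2 : 1 ≤ d2)
    (β ηenc ηdec : ℝ) (hβ : 0 < β) (henc : 0 < ηenc) (hdec : 0 < ηdec)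
    (ζ : ℕ → ℝ) (hζmono : ∀ i j, i ≤ j → ζ j ≤ ζ i) (hζnn : ∀ i, 0 ≤ ζ i)
    (hζzero : ∀ i, min d0 d2 ≤ i → ζ i = 0)
    (F : Matrix (Fin d2) (Fin d2) ℝ) (G : Matrix (Fin d0) (Fin d0) ℝ)
    (hF : Fᵀ * F = 1) (hF' : F * Fᵀ = 1) (hG : Gᵀ * G = 1) (hG' : G * Gᵀ = 1)
    (Z : Matrix (Fin d2) (Fin d0) ℝ)
    (hZ : Z = F * (Matrix.of fun (i : Fin d2) (j : Fin d0) =>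
        if (i : ℕ) = (j : ℕ) then ζ i else 0) * Gᵀ)
    (J : Matrix (Fin d2) (Fin d1) ℝ → Matrix (Fin d0) (Fin d1) ℝ → (Fin d1 → ℝ) → ℝ)
    (hJ : ∀ U V σ, J U V σ = (1 / (2 * ηdec ^ 2)) *
        (frobSq (U * Vᵀ - Z)
          + Matrix.trace (U * Matrix.diagonal (fun i => (σ i) ^ 2) * Uᵀ)
          + β * (ηdec ^ 2 / ηenc ^ 2) * frobSq V)
        + (β / 2) * ∑ i : Fin d1,
            ((σ i) ^ 2 / ηenc ^ 2 - 1 - Real.log ((σ i) ^ 2 / ηenc ^ 2)))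
    (val : ℝ)
    (hval : val = (1 / (2 * ηdec ^ 2)) *
        ((∑ i ∈ Finset.range (min d0 d2), ζ i ^ 2)
          - ∑ i ∈ Finset.range d1, (if β * ηdec ^ 2 < ζ i ^ 2
              then ζ i ^ 2 * (1 + (β * ηdec ^ 2 / ζ i ^ 2)
                * (Real.log (β * ηdec ^ 2 / ζ i ^ 2) - 1))
              else 0))) :
    (∃ (U : Matrix (Fin d2) (Fin d1) ℝ) (V : Matrix (Fin d0) (Fin d1) ℝ)
        (σ : Fin d1 → ℝ), (∀ i, 0 < σ i) ∧ J U V σ = val)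
    ∧ (∀ U V (σ : Fin d1 → ℝ), (∀ i, 0 < σ i) → val ≤ J U V σ) := by
  have hc : 0 < β * ηdec ^ 2 := by positivity
  have he : 0 < ηenc ^ 2 := by positivity
  have hJ' : ∀ U V σ, J U V σ = (1 / (2 * ηdec ^ 2)) *
        (frobSq (U * Vᵀ - Z) + ∑ i, σ i ^ 2 * (Uᵀ * U) i i
          + (β * ηdec ^ 2 / ηenc ^ 2) * frobSq V
        + (β * ηdec ^ 2) * ∑ i : Fin d1,
            ((σ i) ^ 2 / ηenc ^ 2 - 1 - Real.log ((σ i) ^ 2 / ηenc ^ 2))) := by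
    intro U V σ
    rw [hJ, trace_diag]
    field_simp
  have hv : val = (1 / (2 * ηdec ^ 2)) * ((∑ i ∈ Finset.range (min d0 d2), ζ i ^ 2)
        - ∑ i ∈ Finset.range d1, gainG (β * ηdec ^ 2) (ζ i ^ 2)) := hval
  have hZ' : Z = F * rectD d2 d0 ζ * Gᵀ := hZ
  have hgram : ∀ U : Matrix (Fin d2) (Fin d1) ℝ, (F * U)ᵀ * (F * U) = Uᵀ * U := by
    intro U
    rw [Matrix.transpose_mul, Matrix.mul_assoc, ← Matrix.mul_assoc Fᵀ, hF, Matrix.one_mul]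
  constructor
  · obtain ⟨U, V, σ, hσ, h⟩ := attained (d0 := d0) (d1 := d1) (d2 := d2) ζ hζzero
      (β * ηdec ^ 2) (ηenc ^ 2) hc he
    refine ⟨F * U, G * V, σ, hσ, ?_⟩
    rw [hJ', hv, hZ', reduce_obj ζ F G hF hG, hgram, frobSq_left G hG, h]
  · intro U₀ V₀ σ hσ
    obtain ⟨U, rfl⟩ : ∃ U, U₀ = F * U := ⟨Fᵀ * U₀, by rw [← Matrix.mul_assoc, hF', Matrix.one_mul]⟩
    obtain ⟨V, rfl⟩ : ∃ V, V₀ = G * V := ⟨Gᵀ * V₀, by rw [← Matrix.mul_assoc, hG', Matrix.one_mul]⟩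
    rw [hJ', hv, hZ', reduce_obj ζ F G hF hG, hgram, frobSq_left G hG]
    refine mul_le_mul_of_nonneg_left ?_ (by positivity)
    obtain ⟨R, lam, h1, h2, hU⟩ := exists_diag U
    have hs := sigma_bound U R lam h1 h2 hU _ _ hc he (fun i => σ i ^ 2)
      (fun i => pow_pos (hσ i) 2)
    have hb := core_bound ζ hζmono hζnn hζzero (β * ηdec ^ 2) (β * ηdec ^ 2 / ηenc ^ 2) hc
      (div_pos hc he) (U * R) (V * R) lam hU
    have e1 : U * R * (V * R)ᵀ = U * Vᵀ := by
      rw [Matrix.transpose_mul, Matrix.mul_assoc, ← Matrix.mul_assoc R, h2, Matrix.one_mul]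
    rw [e1, frobSq_right R h2] at hb
    linarith
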